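/- arXiv:2411.07689 — 2 statements merged into one kernel-verified Lean document; each statement's English description precedes it below -/
import Mathlib

section
/- Let x be a real number and let θ : [x, +∞) → ℝ be a continuous function which is sublinear, i.e. θ(t)/t → 0 as t → +∞. If y is a real number satisfying y < θ(t) for every t ∈ [x, +∞), then the set E(x, y, θ) := { t > x : for all s ∈ [x, t], θ(s) ≥ ((θ(t) − y)/(t − x))·(s − x) + y } is not bounded above. -/
open Set Filter

/-- Let `θ : [x, +∞) → ℝ` be continuous and sublinear (`θ t / t → 0`), and let `y` be a
real number with `y < θ t` for every `t ≥ x`. Then the set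
`E(x, y, θ) = { t > x : ∀ s ∈ [x, t], θ s ≥ ((θ t − y)/(t − x))·(s − x) + y }`
is not bounded above. -/
theorem lemma1 (x : ℝ) (θ : ℝ → ℝ)
    (hcont : ContinuousOn θ (Ici x))
    (hsub : Tendsto (fun t => θ t / t) atTop (nhds 0))
    (y : ℝ) (hy : ∀ t ∈ Ici x, y < θ t) :
    ¬ BddAbove {t : ℝ | x < t ∧
      ∀ s ∈ Icc x t, ((θ t - y) / (t - x)) * (s - x) + y ≤ θ s} := by
  rintro ⟨M, hM⟩
  set N := max M x + 1 with hN
  have hNM : M < N := by have := le_max_left M x; linarith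
  have hNx : x < N := by have := le_max_right M x; linarith
  obtain ⟨a, ha, hamin⟩ := isCompact_Icc.exists_isMinOn (nonempty_Icc.2 hNx.le)
    (hcont.mono (Icc_subset_Ici_self : Icc x N ⊆ Ici x))
  have hd : 0 < θ a - y := sub_pos.2 (hy a ha.1)
  obtain ⟨m, hm⟩ : ∃ m, m = (θ a - y) / (N - x) := ⟨_, rfl⟩
  have hm0 : 0 < m := hm ▸ div_pos hd (sub_pos.2 hNx)
  have hmN : m * (N - x) = θ a - y := by
    rw [hm]; exact div_mul_cancel₀ _ (sub_pos.2 hNx).ne'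
  have h1 : ∀ᶠ t in atTop, θ t / t < m / 2 := hsub.eventually_lt_const (by linarith)
  obtain ⟨T, hT1, hT2, hT3, hT4⟩ := (h1.and ((eventually_gt_atTop 0).and
    ((eventually_gt_atTop N).and (eventually_gt_atTop ((m * x - y) / (m / 2)))))).exists
  rw [div_lt_iff₀ hT2] at hT1
  rw [div_lt_iff₀ (by linarith)] at hT4
  have hgT : (θ T - y) / (T - x) < m := by
    rw [div_lt_iff₀ (by linarith)]; nlinarith
  have hc : ContinuousOn (fun t => (θ t - y) / (t - x)) (Icc N T) := by
    refine ContinuousOn.div ((hcont.mono ?_).sub continuousOn_const) (by fun_prop) ?_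
    · intro t ht; exact hNx.le.trans ht.1
    · intro t ht; have := ht.1; exact (by linarith : 0 < t - x).ne'
  obtain ⟨t, ht, htmin⟩ := isCompact_Icc.exists_isMinOn (nonempty_Icc.2 hT3.le) hc
  have hmin : ∀ s ∈ Icc N T, (θ t - y) / (t - x) ≤ (θ s - y) / (s - x) := fun s hs => htmin hs
  have htm := (hmin T ⟨hT3.le, le_rfl⟩).trans_lt hgT
  have hxt : x < t := hNx.trans_le ht.1
  have : t ≤ M := by
    refine hM ⟨hxt, fun s hs => ?_⟩
    rcases le_total s N with hsN | hsN
    · have h2 : θ a ≤ θ s := hamin ⟨hs.1, hsN⟩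
      have h3 := mul_le_mul_of_nonneg_right htm.le (sub_nonneg.2 hs.1)
      have h4 := mul_le_mul_of_nonneg_left (sub_le_sub_right hsN x) hm0.le
      linarith
    · have h2 := hmin s ⟨hsN, hs.2.trans ht.2⟩
      rw [le_div_iff₀ (by linarith)] at h2
      linarith
  linarith [ht.1]
end

section
/- Let (u_n)_{n∈ℕ} be a sequence of non-negative real numbers which is summable. Then there exists a summable sequence (v_n)_{n∈ℕ} of non-negative real numbers such that u_n = o(v_n) as n → ∞. -/
/-- Let `(u_n)` be a summable sequence of non-negative real numbers. Then there exists a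
summable sequence `(v_n)` of non-negative real numbers such that `u_n = o(v_n)`, i.e. for
every `ε > 0` there is `N` such that `u_n ≤ ε * v_n` for all `n ≥ N`. -/
theorem summable_exists_summable_littleO (u : ℕ → ℝ)
    (hu : ∀ n, 0 ≤ u n) (hsum : Summable u) :
    ∃ v : ℕ → ℝ, (∀ n, 0 ≤ v n) ∧ Summable v ∧
      ∀ ε > (0:ℝ), ∃ N : ℕ, ∀ n ≥ N, u n ≤ ε * v n := by
  have hR : ∀ n, (∑' k, u (k + n)) = u n + ∑' k, u (k + (n + 1)) := by
    intro n
    have h := ((summable_nat_add_iff n).2 hsum).tsum_eq_zero_add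
    rw [h, zero_add]
    congr 1
    apply tsum_congr
    intro k
    congr 1
    omega
  obtain ⟨R, hRdef⟩ : ∃ R : ℕ → ℝ, R = fun n => ∑' k, u (k + n) := ⟨_, rfl⟩
  have h1 : ∀ n, R n = u n + R (n + 1) := by
    intro n
    rw [hRdef]
    exact hR n
  have h0 : ∀ n, 0 ≤ R n := by
    intro n
    rw [hRdef]
    exact tsum_nonneg fun k => hu _
  have ht : Filter.Tendsto (fun n => √(R n)) Filter.atTop (nhds 0) := by
    have h : Filter.Tendsto R Filter.atTop (nhds 0) := by
      rw [hRdef]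
      exact tendsto_sum_nat_add u
    simpa using h.sqrt
  have hm : ∀ n, √(R (n + 1)) ≤ √(R n) := fun n =>
    Real.sqrt_le_sqrt (by linarith [h1 n, hu n])
  refine ⟨fun n => √(R n) - √(R (n + 1)), fun n => sub_nonneg.2 (hm n), ?_, ?_⟩
  · refine summable_of_sum_range_le (c := √(R 0)) (fun n => sub_nonneg.2 (hm n)) ?_
    intro n
    rw [Finset.sum_range_sub']
    linarith [Real.sqrt_nonneg (R n)]
  · intro ε hε
    obtain ⟨N, hN⟩ := Filter.eventually_atTop.1 (ht.eventually_lt_const (half_pos hε))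
    refine ⟨N, fun n hn => ?_⟩
    have ha := hN n hn
    have hb := hm n
    have e1 := Real.sq_sqrt (h0 n)
    have e2 := Real.sq_sqrt (h0 (n + 1))
    have e3 := h1 n
    have e4 : u n = (√(R n) + √(R (n + 1))) * (√(R n) - √(R (n + 1))) := by
      ring_nf
      ring_nf at e1 e2 e3
      linarith
    rw [e4]
    exact mul_le_mul_of_nonneg_right (by linarith) (sub_nonneg.2 hb)
end
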